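/- Let P be a standard skew tableau with k entries. Define P₀ := P and, for i = 1, …, k, P_i := S(P_{i−1}) and r_i := r(P_{i−1}), where S is Tesler's rightward shift game. Then P_k is the empty tableau, and r₁, …, r_k form the rows of the rectification of P: the rectification of P is the standard tableau of partition shape whose i-th row contains exactly the entries of r_i. -/

import Mathlib

/-- A partition: weakly decreasing, eventually zero. -/
def IsPartition (f : ℕ → ℕ) : Prop :=
  (∀ i, f (i + 1) ≤ f i) ∧ ∃ N, ∀ i, N ≤ i → f i = 0

/-- `b/a` is a single box, located in row `r`. -/
def CoverAt (a b : ℕ → ℕ) (r : ℕ) : Prop :=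
  b r = a r + 1 ∧ ∀ s, s ≠ r → b s = a s

/-- `b` covers `a`: `b/a` is a single box. -/
def CoverP (a b : ℕ → ℕ) : Prop := ∃ r, CoverAt a b r

/-- A standard skew tableau with `k` entries: a saturated chain of partitions. -/
def IsStandard (k : ℕ) (T : ℕ → ℕ → ℕ) : Prop :=
  (∀ i, i ≤ k → IsPartition (T i)) ∧ ∀ i, i < k → CoverP (T i) (T (i + 1))

/-- An almost standard tableau: each step of the chain is a cover or an equality. -/
def IsAlmostStandard (k : ℕ) (T : ℕ → ℕ → ℕ) : Prop :=
  (∀ i, i ≤ k → IsPartition (T i)) ∧ ∀ i, i < k → T (i + 1) = T i ∨ CoverP (T i) (T (i + 1))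

/-- Tesler's rightward shift game: `B = S(A)`, where `A : β⁰ ⊆ ⋯ ⊆ βᵏ` and
`B : α⁰ ⊆ ⋯ ⊆ αᵏ` with `α⁰ = β⁰` and:
(1) if `βⁱ⁺¹ = βⁱ` then `αⁱ⁺¹ = αⁱ`;
(2) if `βⁱ⁺¹/βⁱ` is a box in row `r` and the strip `βⁱ/αⁱ` has no boxes in rows less
than `r`, then `αⁱ⁺¹ = αⁱ`;
(3) otherwise `αⁱ⁺¹/αⁱ` is a box in the largest row `r' < r` containing a box of
`βⁱ/αⁱ`. -/
def TeslerRel (k : ℕ) (A B : ℕ → ℕ → ℕ) : Prop :=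
  B 0 = A 0 ∧
  ∀ i, i < k →
    (A (i + 1) = A i → B (i + 1) = B i) ∧
    (∀ r, CoverAt (A i) (A (i + 1)) r →
      ((∀ r', r' < r → ¬ B i r' < A i r') → B (i + 1) = B i) ∧
      (∀ r', r' < r → B i r' < A i r' →
        (∀ r'', r' < r'' → r'' < r → ¬ B i r'' < A i r'') →
        CoverAt (B i) (B (i + 1)) r'))

/-- Fomin's local rule for a jeu de taquin slide across a pair of horizontal strips. -/
def jRule (a b d : ℕ → ℕ) : ℕ → ℕ
  | 0 => max (d 1) (a 0) + d 0 - b 0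
  | i + 1 => max (d (i + 2)) (a (i + 1)) + min (d (i + 1)) (a i) - b (i + 1)

/-- The inward jeu de taquin slide of the chain `T` with new inner border `a`. -/
def slideIn (T : ℕ → ℕ → ℕ) (a : ℕ → ℕ) : ℕ → ℕ → ℕ
  | 0 => a
  | i + 1 => jRule (slideIn T a i) (T i) (T (i + 1))

def slideOutAux (k : ℕ) (T : ℕ → ℕ → ℕ) (d : ℕ → ℕ) : ℕ → ℕ → ℕ
  | 0 => d
  | m + 1 => jRule (T (k - (m + 1))) (T (k - m)) (slideOutAux k T d m)

/-- The outward jeu de taquin slide of the chain `T` with new outer border `d`. -/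
def slideOut (k : ℕ) (T : ℕ → ℕ → ℕ) (d : ℕ → ℕ) : ℕ → ℕ → ℕ :=
  fun i => slideOutAux k T d (k - i)

/-- One jeu de taquin slide (inward or outward). -/
def SlideRel (k : ℕ) (T T' : ℕ → ℕ → ℕ) : Prop :=
  (∃ a, IsPartition a ∧ CoverP a (T 0) ∧ T' = slideIn T a) ∨
  (∃ d, IsPartition d ∧ CoverP (T k) d ∧ T' = slideOut k T d)

/-- Knuth equivalence of tableaux: connectedness by jeu de taquin slides. -/
def KnuthTab (k : ℕ) : (ℕ → ℕ → ℕ) → (ℕ → ℕ → ℕ) → Prop :=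
  Relation.EqvGen (SlideRel k)

theorem IsPartition.succ_le {f : ℕ → ℕ} (hf : IsPartition f) (i : ℕ) : f (i + 1) ≤ f i := hf.1 i

theorem coverAt_iff {a b : ℕ → ℕ} {r : ℕ} :
    CoverAt a b r ↔ ∀ s, b s = a s + if s = r then 1 else 0 := by
  constructor
  · rintro ⟨h1, h2⟩ s
    by_cases hs : s = r
    · subst hs; simp [h1]
    · simp [hs, h2 s hs]
  · intro h
    exact ⟨by simp [h r], fun s hs => by simp [h s, hs]⟩

theorem CoverAt.row_unique {a b : ℕ → ℕ} {r s : ℕ} (hr : CoverAt a b r) (hs : CoverAt a b s) :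
    r = s := by
  by_contra h
  have h1 := hr.1
  have h2 := hs.2 r h
  omega

theorem CoverAt.ne {a b : ℕ → ℕ} {r : ℕ} (h : CoverAt a b r) : b ≠ a := by
  rintro rfl
  have := h.1
  omega

/-- Adding a box to a partition in row `r` gives a partition as soon as row `r` is shorter than
the row above it. -/
theorem CoverAt.isPartition {a b : ℕ → ℕ} {r : ℕ} (h : CoverAt a b r) (ha : IsPartition a)
    (hr : ∀ s, s + 1 = r → a r < a s) : IsPartition b := by
  rw [coverAt_iff] at h
  obtain ⟨h1, N, hN⟩ := ha
  refine ⟨fun i => ?_, max N (r + 1), fun i hi => ?_⟩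
  · have := h1 i
    have := hr i
    rw [h, h]
    grind
  · rw [h, hN i (by omega)]
    grind

theorem jRule_self {a b : ℕ → ℕ} {p : ℕ} (hb : IsPartition b) (ha : IsPartition a)
    (hab : CoverAt a b p) : jRule a b b = a := by
  rw [coverAt_iff] at hab
  funext s
  cases s with
  | zero =>
    have h1 := ha.succ_le 0
    have h2 := hb.succ_le 0
    have h3 := hab 0
    have h4 := hab 1
    simp only [jRule]
    grind
  | succ s =>
    have h1 := ha.succ_le s
    have h2 := hb.succ_le s
    have h1' := ha.succ_le (s + 1)
    have h2' := hb.succ_le (s + 1)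
    have h3 := hab s
    have h4 := hab (s + 1)
    have h5 := hab (s + 2)
    simp only [jRule]
    grind

theorem jRule_jump {a b d : ℕ → ℕ} {p : ℕ} (ha : IsPartition a) (hb : IsPartition b)
    (hd : IsPartition d) (hab : CoverAt a b p) (hbd : CoverAt b d (p + 1))
    (h : a (p + 1) = a p) :
    CoverAt a (jRule a b d) p ∧ CoverAt (jRule a b d) d (p + 1) := by
  have key : CoverAt a (jRule a b d) p := by
    rw [coverAt_iff] at *
    intro s
    cases s with
    | zero =>
      have := ha.succ_le 0
      have := hb.succ_le 0
      have := hd.succ_le 0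
      have := hab 0
      have := hab 1
      have := hbd 0
      have := hbd 1
      simp only [jRule]
      grind
    | succ s =>
      have := ha.succ_le s
      have := hb.succ_le s
      have := hd.succ_le s
      have := ha.succ_le (s + 1)
      have := hb.succ_le (s + 1)
      have := hd.succ_le (s + 1)
      have := hab s
      have := hab (s + 1)
      have := hab (s + 2)
      have := hbd s
      have := hbd (s + 1)
      have := hbd (s + 2)
      simp only [jRule]
      grind
  refine ⟨key, ?_⟩
  rw [coverAt_iff] at *
  intro s
  rw [hbd, key, hab]

theorem jRule_commute {a b d : ℕ → ℕ} {p r : ℕ} (ha : IsPartition a) (hb : IsPartition b)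
    (hd : IsPartition d) (hab : CoverAt a b p) (hbd : CoverAt b d r)
    (h : r = p + 1 → a (p + 1) ≠ a p) :
    CoverAt a (jRule a b d) r ∧ CoverAt (jRule a b d) d p := by
  have key : CoverAt a (jRule a b d) r := by
    rw [coverAt_iff] at *
    intro s
    cases s with
    | zero =>
      have := ha.succ_le 0
      have := hb.succ_le 0
      have := hd.succ_le 0
      have := hab 0
      have := hab 1
      have := hbd 0
      have := hbd 1
      simp only [jRule]
      grind
    | succ s =>
      have := ha.succ_le s
      have := hb.succ_le s
      have := hd.succ_le s
      have := ha.succ_le (s + 1)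
      have := hb.succ_le (s + 1)
      have := hd.succ_le (s + 1)
      have := hab s
      have := hab (s + 1)
      have := hab (s + 2)
      have := hbd s
      have := hbd (s + 1)
      have := hbd (s + 2)
      simp only [jRule]
      grind
  refine ⟨key, ?_⟩
  rw [coverAt_iff] at *
  intro s
  rw [hbd, key, hab]
  omega

theorem jRule_isPartition {a b d : ℕ → ℕ} {p r : ℕ} (ha : IsPartition a) (hb : IsPartition b)
    (hd : IsPartition d) (hab : CoverAt a b p) (hbd : CoverAt b d r) :
    IsPartition (jRule a b d) := by
  by_cases h : r = p + 1 ∧ a (p + 1) = a p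
  · obtain ⟨rfl, h⟩ := h
    refine (jRule_jump ha hb hd hab hbd h).1.isPartition ha fun s hs => ?_
    have h1 := hb.succ_le s
    rw [hs, hab.1, hab.2 s (by omega)] at h1
    omega
  · refine (jRule_commute ha hb hd hab hbd (by tauto)).1.isPartition ha fun s hs => ?_
    rw [coverAt_iff] at hab hbd
    have := hd.succ_le s
    have := ha.succ_le s
    have := hab s
    have := hab r
    have := hbd s
    have := hbd r
    grind

/-- One step of Tesler's game: the step from `β` to `β'` is turned into one from `α` to `α'`, where
`β / α` is the current strip. -/
def TeslerStep (β α β' α' : ℕ → ℕ) : Prop :=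
  (β' = β → α' = α) ∧
    ∀ r, CoverAt β β' r →
      ((∀ r', r' < r → ¬ α r' < β r') → α' = α) ∧
      (∀ r', r' < r → α r' < β r' → (∀ r'', r' < r'' → r'' < r → ¬ α r'' < β r'') →
        CoverAt α α' r')

theorem exists_last_lt {Q : ℕ → Prop} {r : ℕ} (h : ∃ s, s < r ∧ Q s) :
    ∃ s, s < r ∧ Q s ∧ ∀ t, s < t → t < r → ¬ Q t := by
  classical
  obtain ⟨s, hs, hQ⟩ := h
  refine ⟨Nat.findGreatest Q (r - 1), ?_, Nat.findGreatest_spec (m := s) (by omega) hQ, ?_⟩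
  · have := Nat.findGreatest_le (P := Q) (r - 1)
    omega
  · intro t ht htr
    exact Nat.findGreatest_is_greatest ht (by omega)

theorem TeslerStep.cases {β α β' α' : ℕ → ℕ} {r : ℕ} (h : TeslerStep β α β' α')
    (hr : CoverAt β β' r) :
    ((∀ s, s < r → ¬ α s < β s) ∧ α' = α) ∨
      ∃ s, s < r ∧ α s < β s ∧ (∀ t, s < t → t < r → ¬ α t < β t) ∧ CoverAt α α' s := by
  by_cases hex : ∃ s, s < r ∧ α s < β s
  · obtain ⟨s, hs, h1, h2⟩ := exists_last_lt hex
    exact Or.inr ⟨s, hs, h1, h2, (h.2 r hr).2 s hs h1 h2⟩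
  · have : ∀ s, s < r → ¬ α s < β s := fun s hs h' => hex ⟨s, hs, h'⟩
    exact Or.inl ⟨this, (h.2 r hr).1 this⟩

theorem TeslerStep.of_removed {β α β' : ℕ → ℕ} {r : ℕ} (hr : CoverAt β β' r)
    (h : ∀ s, s < r → ¬ α s < β s) : TeslerStep β α β' α := by
  refine ⟨fun _ => rfl, fun r₁ hr₁ => ⟨fun _ => rfl, fun s hs hlt => ?_⟩⟩
  obtain rfl := hr.row_unique hr₁
  exact absurd hlt (h s hs)

theorem TeslerStep.of_moved {β α β' α' : ℕ → ℕ} {r s : ℕ} (hr : CoverAt β β' r) (hs : s < r)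
    (hlt : α s < β s) (hmax : ∀ t, s < t → t < r → ¬ α t < β t) (hα : CoverAt α α' s) :
    TeslerStep β α β' α' := by
  refine ⟨fun h => absurd h hr.ne, fun r₁ hr₁ => ?_⟩
  obtain rfl := hr.row_unique hr₁
  refine ⟨fun h => absurd hlt (h s hs), fun s₁ hs₁ hlt₁ hmax₁ => ?_⟩
  obtain h | rfl | h := lt_trichotomy s s₁
  · exact absurd hlt₁ (hmax s₁ h hs₁)
  · exact hα
  · exact absurd hlt (hmax₁ s h hs)

/-- `β / α` is a horizontal strip. -/
def IsStrip (α β : ℕ → ℕ) : Prop := ∀ i, α i ≤ β i ∧ β (i + 1) ≤ α i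

theorem IsStrip.step {α β α' β' : ℕ → ℕ} {r : ℕ} (h : IsStrip α β) (hβ' : IsPartition β')
    (hr : CoverAt β β' r) (ht : TeslerStep β α β' α') : IsStrip α' β' := by
  intro i
  have h0 := h i
  have h1 := hβ'.succ_le i
  obtain ⟨hno, rfl⟩ | ⟨s, hs, hlt, hmax, hα⟩ := ht.cases hr
  · rw [coverAt_iff] at hr
    have := hno i
    have := hr i
    have := hr (i + 1)
    grind
  · rw [coverAt_iff] at hr hα
    have := hmax i
    have := hr i
    have := hr (i + 1)
    have := hα i
    grind

/-- The relation kept by the two chains `β` and `γ` linked by a slide and their images `α` and `δ`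
under Tesler's game. -/
structure SlideInvariant (β α γ δ : ℕ → ℕ) (p q : ℕ) : Prop where
  part_β : IsPartition β
  part_α : IsPartition α
  part_γ : IsPartition γ
  part_δ : IsPartition δ
  strip : IsStrip δ γ
  cover_β : CoverAt γ β p
  cover_α : CoverAt δ α q
  row_eq : p = q ∨ p = q + 1 ∧ δ q = γ p

/-- Tesler's game commutes with a slide across a single new box. -/
theorem SlideInvariant.step_rows {β α γ δ β' α' : ℕ → ℕ} {p q r : ℕ}
    (h : SlideInvariant β α γ δ p q) (hβ' : IsPartition β') (hα' : IsPartition α')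
    (hr : CoverAt β β' r) (ht : TeslerStep β α β' α') :
    ∃ p' q' r', CoverAt (jRule γ β β') β' p' ∧ CoverAt (jRule δ α α') α' q' ∧
      CoverAt γ (jRule γ β β') r' ∧
      TeslerStep γ δ (jRule γ β β') (jRule δ α α') ∧
      (p' = q' ∨ p' = q' + 1 ∧ jRule δ α α' q' = jRule γ β β' p') := by
  obtain ⟨hpβ, hpα, hpγ, hpδ, hst, hβ, hα, hpq⟩ := h
  have hβi := coverAt_iff.1 hβ
  have hαi := coverAt_iff.1 hα
  have hri := coverAt_iff.1 hr
  by_cases hj : r = p + 1 ∧ γ (p + 1) = γ p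
  · obtain ⟨rfl, hj⟩ := hj
    obtain ⟨c1, c2⟩ := jRule_jump hpγ hpβ hβ' hβ hr hj
    have c1i := coverAt_iff.1 c1
    have hp0 : δ p = γ p := by have := hst p; omega
    obtain rfl | ⟨rfl, htight⟩ := hpq
    · obtain ⟨hno, rfl⟩ | ⟨s, hs, hlt, hmax, hs'⟩ := ht.cases hr
      · rw [jRule_self hpα hpδ hα]
        refine ⟨p + 1, p, p, c2, hα, c1, TeslerStep.of_removed c1 fun s hs => ?_, Or.inr ⟨rfl, ?_⟩⟩
        · have := hno s; grind
        · grind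
      · have hsp : s < p := by grind
        obtain ⟨e1, e2⟩ := jRule_commute hpδ hpα hα' hα hs' (by omega)
        refine ⟨p + 1, p, p, c2, e2, c1,
          TeslerStep.of_moved c1 hsp ?_ (fun t h1 h2 => ?_) e1, Or.inr ⟨rfl, ?_⟩⟩
        · grind
        · have := hmax t; grind
        · have := coverAt_iff.1 e1 p; grind
    · have hq : δ q < γ q := by
        have := hpβ.succ_le q; have := hβi q; have := hβi (q + 1); grind
      have hlt : α (q + 1) < β (q + 1) := by grind
      have hs' := (ht.2 _ hr).2 (q + 1) (by omega) hlt (by omega)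
      obtain ⟨e1, e2⟩ := jRule_jump hpδ hpα hα' hα hs' (by omega)
      refine ⟨q + 1 + 1, q + 1, q + 1, c2, e2, c1,
        TeslerStep.of_moved c1 (by omega) hq (by omega) e1, Or.inr ⟨rfl, ?_⟩⟩
      have := coverAt_iff.1 e1 (q + 1); grind
  · obtain ⟨c1, c2⟩ := jRule_commute hpγ hpβ hβ' hβ hr (by tauto)
    have c1i := coverAt_iff.1 c1
    obtain rfl | ⟨rfl, htight⟩ := hpq
    · obtain ⟨hno, rfl⟩ | ⟨s, hs, hlt, hmax, hs'⟩ := ht.cases hr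
      · rw [jRule_self hpα hpδ hα]
        refine ⟨p, p, r, c2, hα, c1, TeslerStep.of_removed c1 fun s hs => ?_, Or.inl rfl⟩
        have := hno s; grind
      · obtain ⟨e1, e2⟩ := jRule_commute hpδ hpα hα' hα hs' (by
          rintro rfl heq
          have := hst p; grind)
        refine ⟨p, p, r, c2, e2, c1,
          TeslerStep.of_moved c1 hs ?_ (fun t h1 h2 => ?_) e1, Or.inl rfl⟩
        · grind
        · have := hmax t; grind
    · have hq : δ q < γ q := by
        have := hpβ.succ_le q; have := hβi q; have := hβi (q + 1); grind
      have hle := hst (q + 1)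
      have hlt : α (q + 1) < β (q + 1) := by grind
      obtain ⟨hno, rfl⟩ | ⟨s, hs, hlts, hmax, hs'⟩ := ht.cases hr
      · rw [jRule_self hpα hpδ hα]
        have hrq : r ≤ q := by
          by_contra hrq
          have h1 := hno q
          have h2 := hno (q + 1)
          have h3 := hβ'.succ_le q
          grind
        refine ⟨q + 1, q, r, c2, hα, c1, TeslerStep.of_removed c1 fun s hs => ?_, Or.inr ⟨rfl, ?_⟩⟩
        · have := hno s; grind
        · grind
      · by_cases hjq : s = q + 1 ∧ δ (q + 1) = δ q
        · obtain ⟨rfl, hjq⟩ := hjq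
          obtain ⟨e1, e2⟩ := jRule_jump hpδ hpα hα' hα hs' hjq
          refine ⟨q + 1, q + 1, r, c2, e2, c1,
            TeslerStep.of_moved c1 (by omega) hq (fun t h1 h2 => ?_) e1, Or.inl rfl⟩
          have := hmax t; grind
        · obtain ⟨e1, e2⟩ := jRule_commute hpδ hpα hα' hα hs' (by tauto)
          have hsr : r ≤ q ∨ r = q + 1 ∧ s = q ∨ q + 1 < r ∧ q + 1 ≤ s := by
            have h1 := hmax q
            have h2 := hmax (q + 1)
            have h3 := hβ'.succ_le q
            grind
          have hne : r ≤ q ∨ r = q + 1 ∧ s = q ∨ q + 1 < s ∨ s = q + 1 ∧ δ (q + 1) < γ (q + 1) := by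
            grind
          refine ⟨q + 1, q, r, c2, e2, c1,
            TeslerStep.of_moved c1 hs ?_ (fun t h1 h2 => ?_) e1, Or.inr ⟨rfl, ?_⟩⟩
          · grind
          · have := hmax t; grind
          · have := coverAt_iff.1 e1 q; grind

theorem jRule_step {a b d : ℕ → ℕ} (ha : IsPartition a) (hb : IsPartition b)
    (hd : IsPartition d) (hab : CoverP a b) (hbd : d = b ∨ CoverP b d) :
    IsPartition (jRule a b d) ∧ CoverP (jRule a b d) d ∧
      (d = b ∧ jRule a b d = a ∨ CoverP b d ∧ CoverP a (jRule a b d)) := by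
  obtain ⟨p, hp⟩ := hab
  obtain rfl | ⟨r, hr⟩ := hbd
  · rw [jRule_self hb ha hp]
    exact ⟨ha, ⟨p, hp⟩, Or.inl ⟨rfl, rfl⟩⟩
  · refine ⟨jRule_isPartition ha hb hd hp hr, ?_⟩
    by_cases h : r = p + 1 ∧ a (p + 1) = a p
    · obtain ⟨rfl, h⟩ := h
      obtain ⟨h1, h2⟩ := jRule_jump ha hb hd hp hr h
      exact ⟨⟨_, h2⟩, Or.inr ⟨⟨_, hr⟩, ⟨_, h1⟩⟩⟩
    · obtain ⟨h1, h2⟩ := jRule_commute ha hb hd hp hr (by tauto)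
      exact ⟨⟨_, h2⟩, Or.inr ⟨⟨_, hr⟩, ⟨_, h1⟩⟩⟩

section Slide

variable {k : ℕ} {T : ℕ → ℕ → ℕ} {a : ℕ → ℕ}

theorem slideIn_isPartition_coverP (hT : IsAlmostStandard k T) (ha : IsPartition a)
    (hc : CoverP a (T 0)) :
    ∀ i, i ≤ k → IsPartition (slideIn T a i) ∧ CoverP (slideIn T a i) (T i) := by
  intro i
  induction i with
  | zero => exact fun _ => ⟨ha, hc⟩
  | succ i ih =>
    intro hi
    obtain ⟨h1, h2⟩ := ih (by omega)
    have := jRule_step h1 (hT.1 i (by omega)) (hT.1 (i + 1) hi) h2 (hT.2 i (by omega))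
    exact ⟨this.1, this.2.1⟩

theorem slideIn_succ_cases (hT : IsAlmostStandard k T) (ha : IsPartition a)
    (hc : CoverP a (T 0)) {i : ℕ} (hi : i < k) :
    T (i + 1) = T i ∧ slideIn T a (i + 1) = slideIn T a i ∨
      CoverP (T i) (T (i + 1)) ∧ CoverP (slideIn T a i) (slideIn T a (i + 1)) := by
  obtain ⟨h1, h2⟩ := slideIn_isPartition_coverP hT ha hc i hi.le
  exact (jRule_step h1 (hT.1 i (by omega)) (hT.1 (i + 1) hi) h2 (hT.2 i hi)).2.2

theorem IsAlmostStandard.slideIn (hT : IsAlmostStandard k T) (ha : IsPartition a)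
    (hc : CoverP a (T 0)) : IsAlmostStandard k (slideIn T a) :=
  ⟨fun i hi => (slideIn_isPartition_coverP hT ha hc i hi).1, fun _ hi =>
    (slideIn_succ_cases hT ha hc hi).imp And.right And.right⟩

theorem CoverP.ne {a b : ℕ → ℕ} (h : CoverP a b) : b ≠ a :=
  let ⟨_, hr⟩ := h
  hr.ne

theorem slideIn_succ_eq_iff (hT : IsAlmostStandard k T) (ha : IsPartition a)
    (hc : CoverP a (T 0)) {i : ℕ} (hi : i < k) :
    slideIn T a (i + 1) = slideIn T a i ↔ T (i + 1) = T i := by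
  obtain ⟨h1, h2⟩ | ⟨h1, h2⟩ := slideIn_succ_cases hT ha hc hi
  · exact iff_of_true h2 h1
  · exact iff_of_false h2.ne h1.ne

theorem IsStandard.isAlmostStandard (hT : IsStandard k T) : IsAlmostStandard k T :=
  ⟨hT.1, fun i hi => Or.inr (hT.2 i hi)⟩

theorem IsStandard.slideIn (hT : IsStandard k T) (ha : IsPartition a) (hc : CoverP a (T 0)) :
    IsStandard k (slideIn T a) := by
  refine ⟨(hT.isAlmostStandard.slideIn ha hc).1, fun i hi => ?_⟩
  obtain ⟨h, -⟩ | ⟨-, h⟩ := slideIn_succ_cases hT.isAlmostStandard ha hc hi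
  · exact absurd h (hT.2 i hi).ne
  · exact h

end Slide

theorem SlideInvariant.step {β α γ δ β' α' : ℕ → ℕ} {p q : ℕ}
    (h : SlideInvariant β α γ δ p q) (hβ' : IsPartition β') (hα' : IsPartition α')
    (hβc : β' = β ∨ CoverP β β') (hαc : α' = α ∨ CoverP α α') (ht : TeslerStep β α β' α') :
    (∃ p' q', SlideInvariant β' α' (jRule γ β β') (jRule δ α α') p' q') ∧
      TeslerStep γ δ (jRule γ β β') (jRule δ α α') := by
  have hγ := (jRule_step h.part_γ h.part_β hβ' ⟨p, h.cover_β⟩ hβc).1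
  have hδ := (jRule_step h.part_δ h.part_α hα' ⟨q, h.cover_α⟩ hαc).1
  obtain rfl | ⟨r, hr⟩ := hβc
  · obtain rfl := ht.1 rfl
    rw [jRule_self h.part_β h.part_γ h.cover_β, jRule_self h.part_α h.part_δ h.cover_α]
    exact ⟨⟨p, q, h⟩, fun _ => rfl, fun _ hr => absurd rfl hr.ne⟩
  · obtain ⟨p', q', r', h1, h2, h3, h4, h5⟩ := h.step_rows hβ' hα' hr ht
    exact ⟨⟨p', q', hβ', hα', hγ, hδ, h.strip.step hγ h3 h4, h1, h2, h5⟩, h4⟩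

theorem TeslerRel.slideIn {k : ℕ} {A B : ℕ → ℕ → ℕ} {a : ℕ → ℕ} (hA : IsAlmostStandard k A)
    (hB : IsAlmostStandard k B) (h : TeslerRel k A B) (ha : IsPartition a)
    (hc : CoverP a (A 0)) : TeslerRel k (slideIn A a) (slideIn B a) := by
  have inv : ∀ i, i ≤ k →
      ∃ p q, SlideInvariant (A i) (B i) (_root_.slideIn A a i) (_root_.slideIn B a i) p q := by
    intro i
    induction i with
    | zero =>
      intro _
      obtain ⟨p, hp⟩ := hc
      exact ⟨p, p, hA.1 0 (by omega), hB.1 0 (by omega), ha, ha,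
        fun i => ⟨le_rfl, ha.succ_le i⟩, hp, by rw [h.1]; exact hp, Or.inl rfl⟩
    | succ i ih =>
      intro hi
      obtain ⟨p, q, hpq⟩ := ih (by omega)
      exact (hpq.step (hA.1 _ hi) (hB.1 _ hi) (hA.2 i hi) (hB.2 i hi) (h.2 i hi)).1
  refine ⟨rfl, fun i hi => ?_⟩
  obtain ⟨p, q, hpq⟩ := inv i hi.le
  exact (hpq.step (hA.1 _ hi) (hB.1 _ hi) (hA.2 i hi) (hB.2 i hi) (h.2 i hi)).2

/-- A nonzero partition supported on the first `N` rows has a removable box. -/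
theorem IsPartition.exists_cover {f : ℕ → ℕ} (hf : IsPartition f) {N : ℕ}
    (hN : ∀ i, N ≤ i → f i = 0) (hne : ∃ i, f i ≠ 0) :
    ∃ a r, IsPartition a ∧ CoverAt a f r ∧ r < N := by
  have hne' : ∃ s, s < N ∧ f s ≠ 0 := by
    obtain ⟨i, hi⟩ := hne
    exact ⟨i, by by_contra h; exact hi (hN i (by omega)), hi⟩
  obtain ⟨s, hs, hfs, hmax⟩ := exists_last_lt hne'
  have hlast : f (s + 1) = 0 := by
    by_cases h : s + 1 < N
    · simpa using hmax (s + 1) (by omega) h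
    · exact hN _ (by omega)
  refine ⟨fun i => f i - if i = s then 1 else 0, s, ⟨fun i => ?_, N, fun i hi => ?_⟩, ?_, hs⟩
  · have := hf.succ_le i
    grind
  · simp [hN i hi]
  · rw [coverAt_iff]
    intro i
    grind

/-- On a tableau of partition shape, Tesler's game removes the first row. -/
theorem TeslerRel.straight {k : ℕ} {A B : ℕ → ℕ → ℕ} (hA : IsAlmostStandard k A)
    (h : TeslerRel k A B) (h0 : ∀ r, A 0 r = 0) :
    ∀ j, j ≤ k → ∀ r, B j r = A j (r + 1) := by
  intro j
  induction j with
  | zero => intro _ r; rw [h.1, h0, h0]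
  | succ j ih =>
    intro hj r
    have ih := ih (by omega)
    have ht : TeslerStep (A j) (B j) (A (j + 1)) (B (j + 1)) := h.2 j hj
    obtain heq | ⟨s, hs⟩ := hA.2 j hj
    · rw [ht.1 heq, heq, ih]
    · have hsi := coverAt_iff.1 hs
      cases s with
      | zero =>
        rw [(ht.2 0 hs).1 (by omega), ih, hsi]
        simp
      | succ s =>
        have hlt : B j s < A j s := by
          have := (hA.1 _ hj).succ_le s
          have := hsi s
          have := hsi (s + 1)
          have := ih s
          grind
        have := coverAt_iff.1 ((ht.2 _ hs).2 s (by omega) hlt (by omega)) r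
        rw [this, ih, hsi]
        simp

theorem IsStandard.row_eq_zero {k : ℕ} {R : ℕ → ℕ → ℕ} (hR : IsStandard k R)
    (h0 : ∀ r, R 0 r = 0) : ∀ j, j ≤ k → ∀ r, j ≤ r → R j r = 0 := by
  intro j
  induction j with
  | zero => intro _ r _; exact h0 r
  | succ j ih =>
    intro hj r hr
    have ih := ih (by omega)
    obtain ⟨s, hs⟩ := hR.2 j hj
    have hsi := coverAt_iff.1 hs
    obtain ⟨t, rfl⟩ : ∃ t, r = t + 1 := ⟨r - 1, by omega⟩
    have := (hR.1 _ hj).succ_le t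
    have := ih t (by omega)
    have := ih (t + 1) (by omega)
    have := hsi t
    have := hsi (t + 1)
    grind

/-- The chains obtained from a standard tableau by iterating Tesler's game. -/
structure IsTeslerGame (k : ℕ) (Ps : ℕ → ℕ → ℕ → ℕ) : Prop where
  standard : IsStandard k (Ps 0)
  almost : ∀ i, i ≤ k → IsAlmostStandard k (Ps i)
  step : ∀ i, i < k → TeslerRel k (Ps i) (Ps (i + 1))

namespace IsTeslerGame

variable {k : ℕ} {Ps : ℕ → ℕ → ℕ → ℕ}

theorem zero_eq (h : IsTeslerGame k Ps) : ∀ i, i ≤ k → Ps i 0 = Ps 0 0 := by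
  intro i
  induction i with
  | zero => exact fun _ => rfl
  | succ i ih => intro hi; rw [(h.step i hi).1, ih (by omega)]

theorem slideIn (h : IsTeslerGame k Ps) {a : ℕ → ℕ} (ha : IsPartition a)
    (hc : CoverP a (Ps 0 0)) : IsTeslerGame k fun i => slideIn (Ps i) a where
  standard := h.standard.slideIn ha hc
  almost i hi := (h.almost i hi).slideIn ha (by rwa [h.zero_eq i hi])
  step i hi := TeslerRel.slideIn (h.almost i hi.le) (h.almost (i + 1) hi) (h.step i hi) ha
    (by rwa [h.zero_eq i hi.le])

theorem slideIn_succ_eq_iff (h : IsTeslerGame k Ps) {a : ℕ → ℕ} (ha : IsPartition a)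
    (hc : CoverP a (Ps 0 0)) {i j : ℕ} (hi : i ≤ k) (hj : j < k) :
    _root_.slideIn (Ps i) a (j + 1) = _root_.slideIn (Ps i) a j ↔ Ps i (j + 1) = Ps i j :=
  _root_.slideIn_succ_eq_iff (h.almost i hi) ha (by rwa [h.zero_eq i hi]) hj

theorem straight (h : IsTeslerGame k Ps) (h0 : ∀ r, Ps 0 0 r = 0) :
    ∀ i, i ≤ k → ∀ j, j ≤ k → ∀ r, Ps i j r = Ps 0 j (r + i) := by
  intro i
  induction i with
  | zero => intro _ j _ r; rfl
  | succ i ih =>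
    intro hi j hj r
    have hz : ∀ r, Ps i 0 r = 0 := fun r => by rw [h.zero_eq i (by omega), h0]
    rw [(h.step i hi).straight (h.almost i (by omega)) hz j hj, ih (by omega) j hj]
    congr 1
    omega

/-- The `i`-th row of a tableau of partition shape consists of the entries which the `i`-th game
removes. -/
theorem straight_coverAt_iff (h : IsTeslerGame k Ps) (h0 : ∀ r, Ps 0 0 r = 0) {i j : ℕ}
    (hi : i < k) (hj : j < k) :
    CoverAt (Ps 0 j) (Ps 0 (j + 1)) i ↔
      Ps i (j + 1) ≠ Ps i j ∧ Ps (i + 1) (j + 1) = Ps (i + 1) j := by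
  obtain ⟨s, hs⟩ := h.standard.2 j hj
  have hsi := coverAt_iff.1 hs
  have row (m : ℕ) (hm : m ≤ k) : Ps m (j + 1) = Ps m j ↔ s < m := by
    rw [funext_iff]
    constructor
    · intro heq
      by_contra hlt
      have := heq (s - m)
      rw [h.straight h0 m hm _ hj, h.straight h0 m hm _ hj.le, hsi] at this
      grind
    · intro hlt r
      rw [h.straight h0 m hm _ hj, h.straight h0 m hm _ hj.le, hsi]
      grind
  rw [Ne, row i hi.le, row (i + 1) hi]
  constructor
  · intro hi'
    obtain rfl := hs.row_unique hi'
    omega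
  · intro hsi'
    obtain rfl : s = i := by omega
    exact hs

theorem rectification (n : ℕ) : ∀ {Ps : ℕ → ℕ → ℕ → ℕ}, IsTeslerGame k Ps →
    ∀ N, (∀ i, N ≤ i → Ps 0 0 i = 0) → ∑ i ∈ Finset.range N, Ps 0 0 i = n →
    (∀ j, j < k → Ps k (j + 1) = Ps k j) ∧
    ∃ R : ℕ → ℕ → ℕ, IsStandard k R ∧ (∀ r, R 0 r = 0) ∧ KnuthTab k (Ps 0) R ∧
      ∀ i j, i < k → j < k → (CoverAt (R j) (R (j + 1)) i ↔
        Ps i (j + 1) ≠ Ps i j ∧ Ps (i + 1) (j + 1) = Ps (i + 1) j) := by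
  induction n with
  | zero =>
    intro Ps h N hN hsum
    have h0 : ∀ r, Ps 0 0 r = 0 := by
      intro r
      by_cases hr : r < N
      · exact Finset.sum_eq_zero_iff.1 hsum r (Finset.mem_range.2 hr)
      · exact hN r (by omega)
    refine ⟨fun j hj => ?_, Ps 0, h.standard, h0, Relation.EqvGen.refl _, fun i j hi hj =>
      h.straight_coverAt_iff h0 hi hj⟩
    funext r
    rw [h.straight h0 k le_rfl _ hj, h.straight h0 k le_rfl _ hj.le,
      h.standard.row_eq_zero h0 _ hj _ (by omega), h.standard.row_eq_zero h0 _ hj.le _ (by omega)]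
  | succ n ih =>
    intro Ps h N hN hsum
    have hne : ∃ i, Ps 0 0 i ≠ 0 := by
      by_contra! hz
      simp [hz] at hsum
    obtain ⟨a, r, ha, hc, hr⟩ := (h.standard.1 0 (by omega)).exists_cover hN hne
    have hci := coverAt_iff.1 hc
    have hsum' : ∑ i ∈ Finset.range N, a i = n := by
      simp only [hci, Finset.sum_add_distrib, Finset.sum_ite_eq', Finset.mem_range, hr,
        if_true] at hsum
      omega
    have hN' : ∀ i, N ≤ i → a i = 0 := fun i hi => by
      have := hN i hi
      rw [hci] at this
      omega
    obtain ⟨hempty, R, hR, hR0, hK, hrow⟩ := ih (h.slideIn ha ⟨r, hc⟩) N hN' hsum'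
    refine ⟨fun j hj => (h.slideIn_succ_eq_iff ha ⟨r, hc⟩ le_rfl hj).1 (hempty j hj), R, hR, hR0,
      Relation.EqvGen.trans _ _ _ (Relation.EqvGen.rel _ _ (Or.inl ⟨a, ha, ⟨r, hc⟩, rfl⟩)) hK,
      fun i j hi hj => ?_⟩
    rw [hrow i j hi hj, Ne, h.slideIn_succ_eq_iff ha ⟨r, hc⟩ hi.le hj,
      h.slideIn_succ_eq_iff ha ⟨r, hc⟩ hi hj]

end IsTeslerGame

/-- **Tesler's rightward shift games rectify.**  Let `P` be a standard skew tableau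
with `k` entries; define `P₀ := P`, `Pᵢ := S(P_{i−1})` and
`rᵢ := r(P_{i−1}) = {j : step j of P_{i−1} is a cover but step j of Pᵢ is an equality}`.
Then `P_k` is the empty tableau, and `r₁, …, r_k` form the rows of the rectification of
`P`: the rectification of `P` is the standard tableau `R` of partition shape whose
`i`-th row contains exactly the entries of `rᵢ`. -/
theorem tesler_rectification (k : ℕ) (P : ℕ → ℕ → ℕ) (hP : IsStandard k P)
    (Ps : ℕ → ℕ → ℕ → ℕ) (hPs0 : Ps 0 = P)
    (halmost : ∀ i, i ≤ k → IsAlmostStandard k (Ps i))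
    (hstep : ∀ i, i < k → TeslerRel k (Ps i) (Ps (i + 1))) :
    (∀ i, i ≤ k → Ps k i = Ps k 0) ∧
    ∃ R : ℕ → ℕ → ℕ, IsStandard k R ∧ (∀ r, R 0 r = 0) ∧
      KnuthTab k P R ∧
      (∀ j, 1 ≤ j → j ≤ k → ∀ i, 1 ≤ i → i ≤ k →
        (CoverAt (R (j - 1)) (R j) (i - 1) ↔
          (Ps (i - 1) (j - 1) ≠ Ps (i - 1) j ∧ Ps i (j - 1) = Ps i j))) := by
  subst hPs0
  have h : IsTeslerGame k Ps := ⟨hP, halmost, hstep⟩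
  obtain ⟨N, hN⟩ := (hP.1 0 (Nat.zero_le k)).2
  obtain ⟨hempty, R, hR, hR0, hK, hrow⟩ := h.rectification _ N hN rfl
  refine ⟨fun i => ?_, R, hR, hR0, hK, fun j hj hjk i hi hik => ?_⟩
  · induction i with
    | zero => exact fun _ => rfl
    | succ i ih => intro hi; rw [hempty i hi, ih (by omega)]
  · obtain ⟨j, rfl⟩ : ∃ m, j = m + 1 := ⟨j - 1, by omega⟩
    obtain ⟨i, rfl⟩ : ∃ m, i = m + 1 := ⟨i - 1, by omega⟩
    simp only [Nat.add_sub_cancel]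
    rw [hrow i j hik hjk, ne_comm, eq_comm (a := Ps (i + 1) (j + 1))]
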